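/- arXiv:1202.1250 — 2 statements merged into one kernel-verified Lean document; each statement's English description precedes it below -/
import Mathlib

section
/- Let (D, I) be a nondegenerate real analytic CR-structure on a 3-manifold M, i.e. D ⊂ TM is a rank-2 contact plane field and I : D → D satisfies I² = −Id_D, all real analytic. Then for every point p ∈ M there exists an open neighbourhood U_p of p and a real analytic embedding φ : U_p → ℂ² such that (D, I) is the CR-structure induced on U_p by the embedding φ and the standard complex structure of ℂ². -/
open scoped Topology

/-- The power series in variables indexed by `ι` with coefficients `c`, evaluated on a commutative
Banach algebra `A`. -/
noncomputable def coeffSeries {ι : Type*} [Fintype ι] (c : ∀ n, (Fin n → ι) → ℂ)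
    (A : Type*) [NormedCommRing A] [NormedAlgebra ℂ A] :
    FormalMultilinearSeries ℂ (ι → A) A := fun n =>
  ∑ i : Fin n → ι, c n i • (ContinuousMultilinearMap.mkPiAlgebra ℂ (Fin n) A).compContinuousLinearMap
    (fun k => ContinuousLinearMap.proj (i k))

section coeffSeries

variable {ι : Type*} [Fintype ι] {c : ∀ n, (Fin n → ι) → ℂ}
  {A B : Type*} [NormedCommRing A] [NormedAlgebra ℂ A] [NormedCommRing B] [NormedAlgebra ℂ B]

theorem coeffSeries_apply (n : ℕ) (v : Fin n → ι → A) :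
    coeffSeries c A n v = ∑ i : Fin n → ι, c n i • ∏ k, v k (i k) := by
  simp [coeffSeries]

theorem norm_coeffSeries_le [NormOneClass A] (n : ℕ) :
    ‖coeffSeries c A n‖ ≤ ∑ i : Fin n → ι, ‖c n i‖ := by
  refine (norm_sum_le _ _).trans (Finset.sum_le_sum fun i _ => ?_)
  rw [norm_smul]
  refine mul_le_of_le_one_right (norm_nonneg _) ?_
  refine (ContinuousMultilinearMap.norm_compContinuousLinearMap_le _ _).trans ?_
  rw [ContinuousMultilinearMap.norm_mkPiAlgebra, one_mul]
  refine Finset.prod_le_one (fun _ _ => norm_nonneg _) fun k _ => ?_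
  exact ContinuousLinearMap.opNorm_le_bound _ zero_le_one fun v => by
    simpa using norm_le_pi_norm v (i k)

theorem le_radius_coeffSeries [NormOneClass A] {r : NNReal} {C : ℝ}
    (hc : ∀ n, (∑ i : Fin n → ι, ‖c n i‖) * (r : ℝ) ^ n ≤ C) :
    (r : ENNReal) ≤ (coeffSeries c A).radius :=
  FormalMultilinearSeries.le_radius_of_bound _ C fun n =>
    (mul_le_mul_of_nonneg_right (norm_coeffSeries_le n) (by positivity)).trans (hc n)

theorem hasSum_coeffSeries [NormOneClass A] [CompleteSpace A] {r : NNReal} {C : ℝ}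
    (hc : ∀ n, (∑ i : Fin n → ι, ‖c n i‖) * (r : ℝ) ^ n ≤ C) {a : ι → A} (ha : ‖a‖ < r) :
    HasSum (fun n => ∑ i : Fin n → ι, c n i • ∏ k, a (i k)) ((coeffSeries c A).sum a) := by
  have hmem : a ∈ Metric.eball (0 : ι → A) (coeffSeries c A).radius := by
    refine Metric.eball_subset_eball (le_radius_coeffSeries hc) ?_
    rw [Metric.eball_coe]
    simpa using ha
  simpa only [coeffSeries_apply] using (coeffSeries c A).hasSum hmem

theorem map_coeffSeries_sum [NormOneClass A] [NormOneClass B] [CompleteSpace A] [CompleteSpace B]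
    {r : NNReal} {C : ℝ} (hc : ∀ n, (∑ i : Fin n → ι, ‖c n i‖) * (r : ℝ) ^ n ≤ C)
    (f : A →ₐ[ℂ] B) (hf : ∀ a, ‖f a‖ ≤ ‖a‖) {a : ι → A} (ha : ‖a‖ < r) :
    f ((coeffSeries c A).sum a) = (coeffSeries c B).sum fun j => f (a j) := by
  have hfa : ‖fun j => f (a j)‖ < r :=
    ((pi_norm_le_iff_of_nonneg (norm_nonneg a)).2
      fun j => (hf _).trans (norm_le_pi_norm a j)).trans_lt ha
  have hcont : Continuous f :=
    AddMonoidHomClass.continuous_of_bound f 1 fun a => by simpa using hf a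
  have h := (hasSum_coeffSeries hc ha).map f hcont
  refine h.unique ?_
  have h' := hasSum_coeffSeries hc hfa
  have : (f ∘ fun n => ∑ i : Fin n → ι, c n i • ∏ k, a (i k)) =
      fun n => ∑ i : Fin n → ι, c n i • ∏ k, f (a (i k)) := by
    ext n
    simp only [Function.comp_apply, map_sum, map_smul, map_prod]
  rwa [this]

theorem analyticAt_coeffSeries_sum [NormOneClass A] [CompleteSpace A] {r : NNReal} (hr : 0 < r)
    {C : ℝ} (hc : ∀ n, (∑ i : Fin n → ι, ‖c n i‖) * (r : ℝ) ^ n ≤ C) :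
    AnalyticAt ℂ (coeffSeries c A).sum 0 :=
  ((coeffSeries c A).hasFPowerSeriesOnBall
    ((ENNReal.coe_pos.2 hr).trans_le (le_radius_coeffSeries hc))).analyticAt

end coeffSeries

/-- Every real analytic function is locally given by a complex power series. -/
theorem AnalyticAt.exists_coeffSeries {ι : Type*} [Fintype ι] [DecidableEq ι] {f : (ι → ℝ) → ℂ}
    {p : ι → ℝ} (hf : AnalyticAt ℝ f p) :
    ∃ (c : ∀ n, (Fin n → ι) → ℂ) (r : NNReal) (C : ℝ), 0 < r ∧
      (∀ n, (∑ i : Fin n → ι, ‖c n i‖) * (r : ℝ) ^ n ≤ C) ∧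
      ∀ᶠ y in 𝓝 p, f y = (coeffSeries c ℂ).sum fun j => ((y j - p j : ℝ) : ℂ) := by
  obtain ⟨P, R, hP⟩ := hf
  obtain ⟨r, hr0, hr⟩ := ENNReal.lt_iff_exists_nnreal_btwn.1 hP.r_pos
  obtain ⟨C, hC, hb⟩ := P.norm_mul_pow_le_of_lt_radius (hr.trans_le hP.r_le)
  have hr0' : 0 < r := by exact_mod_cast hr0
  let c : ∀ n, (Fin n → ι) → ℂ := fun n i => P n fun k => Pi.single (i k) 1
  let N : NNReal := Fintype.card ι + 1
  have hN : (0 : NNReal) < N := by positivity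
  refine ⟨c, r / N, C, by positivity, fun n => ?_, ?_⟩
  · have h₁ : (∑ i : Fin n → ι, ‖c n i‖) ≤ N ^ n * ‖P n‖ := by
      have : ∀ i : Fin n → ι, ‖c n i‖ ≤ ‖P n‖ := fun i => by
        refine ((P n).le_opNorm _).trans (mul_le_of_le_one_right (norm_nonneg _) ?_)
        exact Finset.prod_le_one (fun _ _ => norm_nonneg _) fun k _ => by
          simp [Pi.norm_single]
      refine (Finset.sum_le_sum fun i _ => this i).trans ?_
      simp only [Finset.sum_const, Finset.card_univ, Fintype.card_pi, Finset.prod_const,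
        Fintype.card_fin, nsmul_eq_mul]
      push_cast
      gcongr
      simp [N]
    calc (∑ i : Fin n → ι, ‖c n i‖) * ((r / N : NNReal) : ℝ) ^ n
        ≤ N ^ n * ‖P n‖ * ((r / N : NNReal) : ℝ) ^ n := by gcongr
      _ = ‖P n‖ * (r : ℝ) ^ n := by
        have : (N : ℝ) ≠ 0 := by exact_mod_cast hN.ne'
        push_cast
        rw [div_pow]
        field_simp
      _ ≤ C := hb n
  · have : Metric.eball p R ∈ 𝓝 p := Metric.eball_mem_nhds p hP.r_pos
    filter_upwards [this] with y hy
    have hy' : y - p ∈ Metric.eball (0 : ι → ℝ) R := by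
      simpa [edist_eq_enorm_sub] using hy
    have h := hP.hasSum hy'
    rw [add_sub_cancel] at h
    rw [← h.tsum_eq, FormalMultilinearSeries.sum]
    congr 1 with n
    rw [coeffSeries_apply]
    have hsum : y - p = ∑ i, (y i - p i) • (Pi.single i 1 : ι → ℝ) := by
      ext j
      simp [Finset.sum_apply, Pi.single_apply]
    calc P n (fun _ => y - p)
        = P n (fun _ => ∑ i, (y i - p i) • (Pi.single i 1 : ι → ℝ)) := by rw [← hsum]
      _ = ∑ i : Fin n → ι, P n fun k => (y (i k) - p (i k)) • (Pi.single (i k) 1 : ι → ℝ) :=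
        (P n).map_sum _
      _ = _ := Finset.sum_congr rfl fun i _ => by
        rw [(P n).map_smul_univ, smul_eq_mul, mul_comm, Complex.real_smul]
        simp [c]

section Paths

open unitInterval Set

/-- The primitive, vanishing at `0`, of a continuous function on the unit interval. -/
noncomputable def pathPrimitive : C(I, ℂ) →L[ℂ] C(I, ℂ) :=
  LinearMap.mkContinuous
    { toFun := fun u =>
        { toFun := fun s => ∫ t in (0 : ℝ)..s, IccExtend zero_le_one u t
          continuous_toFun := by
            have h : Continuous fun s : ℝ => ∫ t in (0 : ℝ)..s, IccExtend zero_le_one u t :=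
              intervalIntegral.continuous_primitive
                (fun a b => (u.continuous.Icc_extend' (h := zero_le_one)).intervalIntegrable a b) 0
            exact h.comp continuous_subtype_val }
      map_add' := fun u v => by
        ext s
        exact intervalIntegral.integral_add
          ((u.continuous.Icc_extend' (h := zero_le_one)).intervalIntegrable _ _)
          ((v.continuous.Icc_extend' (h := zero_le_one)).intervalIntegrable _ _)
      map_smul' := fun a u => by
        ext s
        exact intervalIntegral.integral_smul a _ } 1 fun u => by
    rw [one_mul, ContinuousMap.norm_le _ (norm_nonneg _)]
    intro s
    refine (intervalIntegral.norm_integral_le_of_norm_le_const (C := ‖u‖) fun t _ =>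
      u.norm_coe_le_norm _).trans ?_
    rw [sub_zero, abs_of_nonneg s.2.1]
    exact mul_le_of_le_one_right (norm_nonneg _) s.2.2

theorem pathPrimitive_apply (u : C(I, ℂ)) (s : I) :
    pathPrimitive u s = ∫ t in (0 : ℝ)..s, IccExtend zero_le_one u t := rfl

/-- Precomposition of paths with the dilation by `c`. -/
noncomputable def pathDilate (c : I) : C(I, ℂ) →ₐ[ℂ] C(I, ℂ) :=
  ContinuousMap.compRightAlgHom ℂ ℂ ⟨fun s => c * s, by fun_prop⟩

theorem pathDilate_apply (c s : I) (u : C(I, ℂ)) : pathDilate c u s = u (c * s) := rfl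

theorem norm_pathDilate_le (c : I) (u : C(I, ℂ)) : ‖pathDilate c u‖ ≤ ‖u‖ :=
  (ContinuousMap.norm_le _ (norm_nonneg _)).2 fun _ => u.norm_coe_le_norm _

theorem pathDilate_pathPrimitive (c : I) (u : C(I, ℂ)) :
    pathDilate c (pathPrimitive u) = (c : ℂ) • pathPrimitive (pathDilate c u) := by
  ext s
  rw [pathDilate_apply, ContinuousMap.smul_apply, pathPrimitive_apply, pathPrimitive_apply]
  have h : (∫ t in (0 : ℝ)..s, IccExtend zero_le_one (pathDilate c u) t) =
      ∫ t in (0 : ℝ)..s, IccExtend zero_le_one u (c * t) := by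
    refine intervalIntegral.integral_congr fun t ht => ?_
    rw [uIcc_of_le s.2.1] at ht
    have ht' : t ∈ Icc (0 : ℝ) 1 := ⟨ht.1, ht.2.trans s.2.2⟩
    change IccExtend zero_le_one (pathDilate c u) t = IccExtend zero_le_one u (c * t)
    rw [IccExtend_of_mem _ _ ht', IccExtend_of_mem _ _ (unitInterval.mul_mem c.2 ht')]
    rfl
  rw [h]
  have := intervalIntegral.smul_integral_comp_mul_left
    (a := 0) (b := s) (fun t => IccExtend zero_le_one u t) (c : ℝ)
  rw [mul_zero] at this
  rw [← Complex.coe_smul] at this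
  exact this.symm

theorem hasDerivAt_integral_IccExtend (u : C(I, ℂ)) (s : I) :
    HasDerivAt (fun s : ℝ => ∫ t in (0 : ℝ)..s, IccExtend zero_le_one u t) (u s) s := by
  have hu : Continuous (IccExtend zero_le_one u) := u.continuous.Icc_extend'
  simpa using intervalIntegral.integral_hasDerivAt_right (hu.intervalIntegrable 0 s)
    (hu.stronglyMeasurableAtFilter _ _) hu.continuousAt

end Paths

section Flow

open unitInterval Set

/-- The holomorphic vector field with convergent power series components `c j` has a local
holomorphic flow. -/
theorem exists_analyticAt_flow {ι : Type*} [Fintype ι] {c : ι → ∀ n, (Fin n → ι) → ℂ}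
    {r : ι → NNReal} {C : ι → ℝ} (hr : ∀ j, 0 < r j)
    (hc : ∀ j n, (∑ i : Fin n → ι, ‖c j n i‖) * (r j : ℝ) ^ n ≤ C j) :
    ∃ γ : (ι → ℂ) × ℂ → (ι → ℂ), AnalyticAt ℂ γ 0 ∧ (∀ᶠ x in 𝓝 0, γ (x, 0) = x) ∧
      ∀ᶠ z in 𝓝 0, fderiv ℂ γ z (0, 1) = fun j => (coeffSeries (c j) ℂ).sum (γ z) := by
  let V : (ι → C(I, ℂ)) → (ι → C(I, ℂ)) := fun a j => (coeffSeries (c j) C(I, ℂ)).sum a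
  let J : (ι → C(I, ℂ)) →L[ℂ] (ι → C(I, ℂ)) :=
    ContinuousLinearMap.pi fun j => pathPrimitive ∘L ContinuousLinearMap.proj j
  let K : (ι → ℂ) →L[ℂ] (ι → C(I, ℂ)) :=
    ContinuousLinearMap.pi fun j => (ContinuousLinearMap.proj j).smulRight (1 : C(I, ℂ))
  let f : ((ι → ℂ) × ℂ) × (ι → C(I, ℂ)) → (ι → C(I, ℂ)) := fun v => v.2 - K v.1.1 - v.1.2 • J (V v.2)
  have hV : AnalyticAt ℂ V 0 :=
    AnalyticAt.pi fun j => analyticAt_coeffSeries_sum (hr j) (hc j)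
  have hf : AnalyticAt ℂ f 0 := by
    have hV' : AnalyticAt ℂ (fun v : ((ι → ℂ) × ℂ) × (ι → C(I, ℂ)) => V v.2) 0 :=
      AnalyticAt.fun_comp (x := (0 : ((ι → ℂ) × ℂ) × (ι → C(I, ℂ)))) hV analyticAt_snd
    have hJ : AnalyticAt ℂ (fun v : ((ι → ℂ) × ℂ) × (ι → C(I, ℂ)) => J (V v.2)) 0 :=
      (J.analyticAt _).comp hV'
    have hK : AnalyticAt ℂ (fun v : ((ι → ℂ) × ℂ) × (ι → C(I, ℂ)) => K v.1.1) 0 :=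
      (K.analyticAt _).comp (analyticAt_fst.comp analyticAt_fst)
    exact (analyticAt_snd.sub hK).sub ((analyticAt_snd.comp analyticAt_fst).smul hJ)
  have hzero : ∀ a : ι → C(I, ℂ), (0 : ℂ) • a = 0 := fun a => zero_smul ℂ a
  have hf0 : f 0 = 0 := by simp [f, hzero]
  have hfc : ContDiffAt ℂ ⊤ f 0 := hf.contDiffAt
  have hn : (⊤ : WithTop ℕ∞) ≠ 0 := by simp
  have hd : fderiv ℂ f 0 ∘L .inr ℂ ((ι → ℂ) × ℂ) (ι → C(I, ℂ)) = .id ℂ _ := by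
    have h₁ : HasFDerivAt f (fderiv ℂ f 0)
        (ContinuousLinearMap.inr ℂ ((ι → ℂ) × ℂ) (ι → C(I, ℂ)) 0) := by
      rw [map_zero]
      exact hf.differentiableAt.hasFDerivAt
    have h₂ := h₁.comp 0 (ContinuousLinearMap.inr ℂ ((ι → ℂ) × ℂ) (ι → C(I, ℂ))).hasFDerivAt
    refine h₂.unique ((hasFDerivAt_id (𝕜 := ℂ) (0 : ι → C(I, ℂ))).congr_of_eventuallyEq ?_)
    exact Filter.Eventually.of_forall fun u => by simp [f, hzero]
  have hinv : (fderiv ℂ f 0 ∘L .inr ℂ ((ι → ℂ) × ℂ) (ι → C(I, ℂ))).IsInvertible := by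
    rw [hd]
    exact ⟨.refl ℂ _, rfl⟩
  let ψ := hfc.implicitFunction hn hinv
  have hψ0 : ψ 0 = 0 := hfc.implicitFunction_apply_self hn hinv
  have hψ : AnalyticAt ℂ ψ 0 := (hfc.contDiffAt_implicitFunction hn hinv).analyticAt
  let ev (s : I) : (ι → C(I, ℂ)) →L[ℂ] (ι → ℂ) :=
    ContinuousLinearMap.pi fun j => ContinuousMap.evalCLM ℂ s ∘L ContinuousLinearMap.proj j
  let γ : (ι → ℂ) × ℂ → (ι → ℂ) := fun z => ev 1 (ψ z)
  have hγ : AnalyticAt ℂ γ 0 := ((ev 1).analyticAt _).comp hψ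
  have hE₁ : ∀ᶠ z in 𝓝 0, f (z, ψ z) = 0 := by
    have := hfc.eventually_apply_implicitFunction hn hinv
    rwa [hf0] at this
  have hE₂ : ∀ᶠ v in 𝓝 0, f v = 0 ↔ ψ v.1 = v.2 := by
    simpa only [hf0] using hfc.eventually_apply_eq_iff_implicitFunction hn hinv
  obtain ⟨ε, hε, hball⟩ := Metric.eventually_nhds_iff_ball.1 hE₂
  have hsmall : ∀ δ : ℝ, 0 < δ → ∀ᶠ z in 𝓝 0, ‖ψ z‖ < δ := fun δ hδ => by
    have := hψ.continuousAt.norm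
    rw [ContinuousAt, hψ0, norm_zero] at this
    exact this.eventually_lt_const hδ
  have hgood : ∀ᶠ z in 𝓝 (0 : (ι → ℂ) × ℂ), f (z, ψ z) = 0 ∧ ‖z‖ < ε ∧ ‖ψ z‖ < ε ∧
      (∀ j, ‖ψ z‖ < r j) ∧ AnalyticAt ℂ γ z := by
    refine hE₁.and (.and ?_ ((hsmall ε hε).and (.and ?_ hγ.eventually_analyticAt)))
    · filter_upwards [Metric.ball_mem_nhds (0 : (ι → ℂ) × ℂ) hε] with z hz using by simpa using hz
    · exact Filter.eventually_all.2 fun j => hsmall _ (hr j)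
  have hdil : ∀ z : (ι → ℂ) × ℂ, f (z, ψ z) = 0 → ‖z‖ < ε → ‖ψ z‖ < ε → (∀ j, ‖ψ z‖ < r j) →
      ∀ t : I, ψ (z.1, t * z.2) = fun j => pathDilate t (ψ z j) := by
    intro z hz hzε hψε hψr t
    refine (hball ((z.1, t * z.2), fun j => pathDilate t (ψ z j)) ?_).1 ?_
    · have h₁ : ‖(t : ℂ) * z.2‖ ≤ ‖z.2‖ := by
        rw [norm_mul]
        refine mul_le_of_le_one_left (norm_nonneg _) ?_
        rw [Complex.norm_real, Real.norm_of_nonneg t.2.1]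
        exact t.2.2
      have h₂ : ‖fun j => pathDilate t (ψ z j)‖ ≤ ‖ψ z‖ :=
        (pi_norm_le_iff_of_nonneg (norm_nonneg _)).2
          fun j => (norm_pathDilate_le _ _).trans (norm_le_pi_norm _ j)
      rw [mem_ball_zero_iff, Prod.norm_def, Prod.norm_def]
      rw [Prod.norm_def] at hzε
      exact max_lt (max_lt ((le_max_left _ _).trans_lt hzε)
        (h₁.trans_lt ((le_max_right _ _).trans_lt hzε))) (h₂.trans_lt hψε)
    · ext1 j
      have h := congrArg (pathDilate t) (congrFun hz j)
      have hmap := map_coeffSeries_sum (hc j) (pathDilate t) (norm_pathDilate_le t) (hψr j)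
      simp only [f, J, K, V, Pi.sub_apply, Pi.smul_apply, ContinuousLinearMap.pi_apply,
        ContinuousLinearMap.smulRight_apply, ContinuousLinearMap.proj_apply, map_sub, map_smul,
        map_one, Pi.zero_apply, map_zero, ContinuousLinearMap.comp_apply,
        pathDilate_pathPrimitive] at h ⊢
      rw [← hmap, ← h, mul_comm, mul_smul]
  refine ⟨γ, hγ, ?_, ?_⟩
  · have ht : Filter.Tendsto (fun x : ι → ℂ => (x, (0 : ℂ))) (𝓝 0) (𝓝 0) :=
      Continuous.tendsto' (by fun_prop) _ _ rfl
    filter_upwards [ht.eventually hE₁] with x hx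
    simp only [f, hzero, sub_zero, sub_eq_zero] at hx
    ext j
    simp [γ, hx, ev, K]
  · obtain ⟨δ, hδ, hgood⟩ := Metric.eventually_nhds_iff_ball.1 hgood
    filter_upwards [Metric.ball_mem_nhds _ hδ] with z hz
    obtain ⟨t, l, hl, htl, hlδ⟩ : ∃ (t : I) (l : ℂ), l ≠ 0 ∧ z.2 = t * l ∧
        (z.1, l) ∈ Metric.ball 0 δ := by
      rw [mem_ball_zero_iff, Prod.norm_def] at hz
      rcases eq_or_ne z.2 0 with h | h
      · refine ⟨0, (δ / 2 : ℝ), by simpa using hδ.ne', by simp [h], ?_⟩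
        rw [mem_ball_zero_iff, Prod.norm_def]
        refine max_lt ((le_max_left _ _).trans_lt hz) ?_
        rw [Complex.norm_real, Real.norm_of_nonneg (by positivity)]
        linarith
      · exact ⟨1, z.2, h, by simp, by rwa [mem_ball_zero_iff, Prod.norm_def]⟩
    obtain ⟨hw, hwε, hψε, hψr, -⟩ := hgood _ hlδ
    have hzan := (hgood _ hz).2.2.2.2
    have hD := hdil _ hw hwε hψε hψr
    dsimp only at hD
    set u := ψ (z.1, l) with hu
    have hz' : z = (z.1, (t : ℂ) * l) := by rw [← htl]
    have hγs : ∀ s : I, γ (z.1, s * l) = fun j => u j s := fun s => by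
      ext j
      simp [γ, hD s, ev, pathDilate_apply]
    have hus : ∀ j (s : I), u j s = z.1 j + l * pathPrimitive (V u j) s := fun j s => by
      have := congrArg (fun a : C(I, ℂ) => a s) (congrFun hw j)
      simp only [f, J, K, Pi.sub_apply, Pi.smul_apply, ContinuousLinearMap.pi_apply,
        ContinuousLinearMap.smulRight_apply, ContinuousLinearMap.proj_apply, Pi.zero_apply,
        ContinuousLinearMap.comp_apply, ContinuousMap.sub_apply, ContinuousMap.smul_apply,
        ContinuousMap.zero_apply, ContinuousMap.one_apply, smul_eq_mul, mul_one] at this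
      linear_combination this
    have hVt : ∀ j, V u j t = (coeffSeries (c j) ℂ).sum (γ z) := fun j => by
      have := map_coeffSeries_sum (hc j) (ContinuousMap.evalAlgHom ℂ ℂ t)
        (fun a => a.norm_coe_le_norm t) (hψr j)
      rw [hz', hγs]
      exact this
    ext j
    rw [← hVt]
    have h₁ : HasDerivWithinAt (fun s : ℝ => γ (z.1, s * l) j) (fderiv ℂ γ z (0, l) j)
        (Icc 0 1) t := by
      have hc₁ : HasDerivAt (fun s : ℝ => ((z.1, (s : ℂ) * l) : (ι → ℂ) × ℂ)) (0, l) (t : ℝ) := by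
        refine (hasDerivAt_const _ _).prodMk ?_
        simpa using (Complex.ofRealCLM.hasDerivAt (x := (t : ℝ))).mul_const l
      have hc₂ : HasFDerivAt γ ((fderiv ℂ γ z).restrictScalars ℝ) (z.1, ((t : ℝ) : ℂ) * l) := by
        rw [← hz']
        exact hzan.differentiableAt.hasFDerivAt.restrictScalars ℝ
      exact (hasDerivAt_pi.1 (hc₂.comp_hasDerivAt (t : ℝ) hc₁) j).hasDerivWithinAt
    have h₂ : HasDerivWithinAt (fun s : ℝ => γ (z.1, s * l) j) (l * V u j t) (Icc 0 1) t := by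
      refine ((((hasDerivAt_integral_IccExtend (V u j) t).const_mul l).const_add
        (z.1 j)).hasDerivWithinAt).congr_of_mem (fun s hs => ?_) t.2
      rw [congrFun (hγs ⟨s, hs⟩) j, hus, pathPrimitive_apply]
    have h₃ := (uniqueDiffOn_Icc zero_lt_one t t.2).eq_deriv _ h₁ h₂
    have h₄ : ((0 : ι → ℂ), l) = l • ((0 : ι → ℂ), (1 : ℂ)) := by simp
    rw [h₄, map_smul, Pi.smul_apply, smul_eq_mul] at h₃
    exact mul_left_cancel₀ hl h₃

end Flow

section FirstIntegrals

/-- A holomorphic vector field with a local holomorphic flow which does not vanish at the origin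
has, near the origin, a complete system of holomorphic first integrals. -/
theorem exists_firstIntegrals_of_flow {n : ℕ} {V : (Fin (n + 1) → ℂ) → (Fin (n + 1) → ℂ)}
    {γ : (Fin (n + 1) → ℂ) × ℂ → (Fin (n + 1) → ℂ)} (hV : V 0 ≠ 0) (hγ : AnalyticAt ℂ γ 0)
    (hγ₀ : ∀ᶠ x in 𝓝 0, γ (x, 0) = x)
    (hγV : ∀ᶠ z in 𝓝 0, fderiv ℂ γ z (0, 1) = V (γ z)) :
    ∃ φ : (Fin (n + 1) → ℂ) → (Fin n → ℂ), AnalyticAt ℂ φ 0 ∧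
      ∀ᶠ y in 𝓝 0, ∀ v, fderiv ℂ φ y v = 0 ↔ ∃ a : ℂ, v = a • V y := by
  obtain ⟨L, hL⟩ : ∃ L : (ℂ × (Fin n → ℂ)) ≃L[ℂ] (Fin (n + 1) → ℂ), L (1, 0) = V 0 := by
    let L₀ : (ℂ × (Fin n → ℂ)) ≃L[ℂ] (Fin (n + 1) → ℂ) := Fin.consEquivL ℂ fun _ => ℂ
    have h₀ : L₀ (1, 0) ≠ 0 := by simp
    obtain ⟨M, hM⟩ := SeparatingDual.exists_continuousLinearEquiv_apply_eq (R := ℂ) h₀ hV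
    exact ⟨L₀.trans M, hM⟩
  let S : (ℂ × (Fin n → ℂ)) →L[ℂ] (Fin (n + 1) → ℂ) × ℂ :=
    (L.toContinuousLinearMap ∘L .inr ℂ ℂ _ ∘L .snd ℂ _ _).prod (.fst ℂ _ _)
  have hS : ∀ a w, S (a, w) = (L (0, w), a) := fun a w => rfl
  have hS0 : S 0 = 0 := map_zero S
  have hΨ : AnalyticAt ℂ (γ ∘ S) 0 := by
    rw [← hS0] at hγ
    exact hγ.comp (S.analyticAt 0)
  have hΨc : ContDiffAt ℂ ⊤ (γ ∘ S) 0 := hΨ.contDiffAt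
  have hn : (⊤ : WithTop ℕ∞) ≠ 0 := by simp
  have hγ00 : γ 0 = 0 := hγ₀.self_of_nhds
  have hΨ0 : (γ ∘ S) 0 = 0 := by simp [hγ00]
  have hd₁ : ∀ x, fderiv ℂ γ 0 (x, 0) = x := by
    have h₁ : HasFDerivAt γ (fderiv ℂ γ 0)
        (ContinuousLinearMap.inl ℂ (Fin (n + 1) → ℂ) ℂ 0) := by
      rw [map_zero]
      exact hγ.differentiableAt.hasFDerivAt
    have h₂ := h₁.comp 0 (ContinuousLinearMap.inl ℂ (Fin (n + 1) → ℂ) ℂ).hasFDerivAt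
    have h₃ := h₂.unique
      ((hasFDerivAt_id (𝕜 := ℂ) (0 : Fin (n + 1) → ℂ)).congr_of_eventuallyEq hγ₀)
    exact fun x => DFunLike.congr_fun h₃ x
  have hd : HasFDerivAt (γ ∘ S) (L : (ℂ × (Fin n → ℂ)) →L[ℂ] (Fin (n + 1) → ℂ)) 0 := by
    have h₁ : HasFDerivAt γ (fderiv ℂ γ 0) (S 0) := by
      rw [hS0]
      exact hγ.differentiableAt.hasFDerivAt
    refine (h₁.comp 0 S.hasFDerivAt).congr_fderiv ?_
    refine ContinuousLinearMap.ext fun ⟨a, w⟩ => ?_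
    have h₂ : S (a, w) = (L (0, w), 0) + a • (0, 1) := by simp [hS]
    have h₃ : ((a, w) : ℂ × (Fin n → ℂ)) = (0, w) + a • (1, 0) := by simp
    rw [ContinuousLinearMap.comp_apply, h₂, map_add, map_smul, hd₁, hγV.self_of_nhds, hγ00, ← hL]
    conv_rhs => rw [h₃]
    rw [map_add, map_smul]
    rfl
  let Θ := hΨc.localInverse hd hn
  have hstrict := hΨc.hasStrictFDerivAt' hd hn
  have hΘ : AnalyticAt ℂ Θ 0 := by
    have := (hΨc.to_localInverse hd hn).analyticAt
    rwa [hΨ0] at this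
  have hΘ0 : Θ 0 = 0 := by
    have := hΨc.localInverse_apply_image hd hn
    rwa [hΨ0] at this
  have hΘt : Filter.Tendsto Θ (𝓝 0) (𝓝 0) := by
    have := hΘ.continuousAt.tendsto
    rwa [hΘ0] at this
  have hright : ∀ᶠ y in 𝓝 0, (γ ∘ S) (Θ y) = y := by
    have := hstrict.eventually_right_inverse
    rwa [hΨ0] at this
  have hleft : ∀ᶠ q in 𝓝 0, Θ ((γ ∘ S) q) = q := hstrict.eventually_left_inverse
  have hSt : Filter.Tendsto (fun y => S (Θ y)) (𝓝 0) (𝓝 0) := by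
    have := (S.continuous.tendsto 0).comp hΘt
    rwa [hS0] at this
  refine ⟨fun y => (Θ y).2, (analyticAt_snd.comp hΘ :), ?_⟩
  filter_upwards [hright.eventually_nhds, hΘt.eventually hleft.eventually_nhds,
    hSt.eventually hγV, hΘ.eventually_analyticAt, hSt.eventually hγ.eventually_analyticAt]
    with y hr hl hv hΘy hγy v
  have hΘ' : HasFDerivAt Θ (fderiv ℂ Θ y) y := hΘy.differentiableAt.hasFDerivAt
  have hΨ' : HasFDerivAt (γ ∘ S) (fderiv ℂ γ (S (Θ y)) ∘L S) (Θ y) :=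
    hγy.differentiableAt.hasFDerivAt.comp _ S.hasFDerivAt
  have hry : (γ ∘ S) (Θ y) = y := hr.self_of_nhds
  have hinv₁ : ∀ v, fderiv ℂ γ (S (Θ y)) (S (fderiv ℂ Θ y v)) = v := fun v =>
    DFunLike.congr_fun ((hΨ'.comp y hΘ').unique
      ((hasFDerivAt_id y).congr_of_eventuallyEq hr)) v
  have hinv₂ : ∀ q, fderiv ℂ Θ y (fderiv ℂ γ (S (Θ y)) (S q)) = q := fun q => by
    have hΘγ : HasFDerivAt Θ (fderiv ℂ Θ y) ((γ ∘ S) (Θ y)) := by rwa [hry]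
    exact DFunLike.congr_fun ((hΘγ.comp _ hΨ').unique
      ((hasFDerivAt_id _).congr_of_eventuallyEq hl)) q
  have hdir : ∀ a : ℂ, fderiv ℂ γ (S (Θ y)) (S (a, 0)) = a • V y := fun a => by
    have h₁ : S (a, 0) = a • (0, 1) := by simp [hS]
    rw [h₁, map_smul, hv, ← Function.comp_apply (f := γ), hry]
  have hφ : fderiv ℂ (fun y => (Θ y).2) y v = (fderiv ℂ Θ y v).2 := by
    rw [hΘ'.snd.fderiv]
    rfl
  rw [hφ]
  constructor
  · intro h
    refine ⟨(fderiv ℂ Θ y v).1, ?_⟩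
    rw [← hdir, ← h, Prod.mk.eta, hinv₁]
  · rintro ⟨a, rfl⟩
    rw [← hdir, hinv₂]

/-- A complex valued real analytic vector field which does not vanish at `p` has, near `p`, a
complete system of complex valued real analytic first integrals. -/
theorem exists_real_firstIntegrals {n : ℕ} {F : (Fin (n + 1) → ℝ) → (Fin (n + 1) → ℂ)}
    {p : Fin (n + 1) → ℝ} (hF : AnalyticAt ℝ F p) (hFp : F p ≠ 0) :
    ∃ φ : (Fin (n + 1) → ℝ) → (Fin n → ℂ), AnalyticAt ℝ φ p ∧
      ∀ᶠ y in 𝓝 p, ∃ T : (Fin (n + 1) → ℂ) →L[ℂ] (Fin n → ℂ),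
        (∀ v, fderiv ℝ φ y v = T fun j => (v j : ℂ)) ∧ ∀ w, T w = 0 ↔ ∃ a : ℂ, w = a • F y := by
  have hFj : ∀ j, AnalyticAt ℝ (fun y => F y j) p := fun j =>
    ((ContinuousLinearMap.proj (R := ℝ) (φ := fun _ : Fin (n + 1) => ℂ) j).analyticAt _).comp hF
  choose c r C hr hc heq using fun j => (hFj j).exists_coeffSeries
  obtain ⟨γ, hγ, hγ₀, hγV⟩ := exists_analyticAt_flow hr hc
  let V : (Fin (n + 1) → ℂ) → (Fin (n + 1) → ℂ) := fun w j => (coeffSeries (c j) ℂ).sum w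
  let R : (Fin (n + 1) → ℝ) →L[ℝ] (Fin (n + 1) → ℂ) :=
    ContinuousLinearMap.pi fun j => Complex.ofRealCLM ∘L ContinuousLinearMap.proj j
  have hFV : ∀ᶠ y in 𝓝 p, F y = V (R (y - p)) := by
    filter_upwards [Filter.eventually_all.2 heq] with y hy
    ext j
    exact hy j
  have hV0 : V 0 ≠ 0 := by
    have := hFV.self_of_nhds
    rw [sub_self, map_zero] at this
    rwa [← this]
  obtain ⟨φ, hφ, hker⟩ := exists_firstIntegrals_of_flow hV0 hγ hγ₀ hγV
  have hRt : Filter.Tendsto (fun y => R (y - p)) (𝓝 p) (𝓝 0) :=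
    Continuous.tendsto' (by fun_prop) _ _ (by simp)
  refine ⟨fun y => φ (R (y - p)), ?_, ?_⟩
  · have h₁ : AnalyticAt ℝ φ (R (p - p)) := by
      rw [sub_self, map_zero]
      exact hφ.restrictScalars
    have h₂ : AnalyticAt ℝ (fun y => y - p) p := analyticAt_id.fun_sub analyticAt_const
    have h₃ : AnalyticAt ℝ (fun y => R (y - p)) p :=
      AnalyticAt.fun_comp (f := fun y => y - p) (R.analyticAt (p - p)) h₂
    exact AnalyticAt.fun_comp (f := fun y => R (y - p)) h₁ h₃
  · filter_upwards [hFV, hRt.eventually hker, hRt.eventually hφ.eventually_analyticAt]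
      with y hy hk ha
    refine ⟨fderiv ℂ φ (R (y - p)), fun v => ?_, fun w => ?_⟩
    · have h₁ := (ha.differentiableAt.hasFDerivAt.restrictScalars ℝ).comp y
        (R.hasFDerivAt.comp y ((hasFDerivAt_id y).sub_const p))
      exact DFunLike.congr_fun h₁.fderiv v
    · rw [hk, hy]

end FirstIntegrals

/-- An immersion is locally an embedding. -/
theorem HasStrictFDerivAt.exists_isEmbedding_domRestrict {E G : Type*} [NormedAddCommGroup E]
    [NormedSpace ℝ E] [FiniteDimensional ℝ E] [NormedAddCommGroup G] [NormedSpace ℝ G]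
    {f : E → G} {f' : E →L[ℝ] G} {a : E} (hf : HasStrictFDerivAt f f' a)
    (hf' : Function.Injective f') :
    ∃ s ∈ 𝓝 a, ∀ t ⊆ s, Topology.IsEmbedding (t.domRestrict f) := by
  obtain ⟨K, hK, hanti⟩ := f'.toLinearMap.exists_antilipschitzWith (LinearMap.ker_eq_bot.2 hf')
  have hK2 : 0 < K⁻¹ / 2 := by positivity
  obtain ⟨s, hs, happ⟩ := hf.approximates_deriv_on_nhds (c := K⁻¹ / 2) (Or.inr hK2)
  refine ⟨s, hs, fun t ht => ?_⟩
  have happ' := happ.mono_set ht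
  have h₁ : AntilipschitzWith K fun x : t => f' x := by
    have h := hanti.comp (AntilipschitzWith.subtype_coe t)
    rwa [one_mul] at h
  exact (h₁.add_sub_lipschitzWith (g := t.domRestrict f) happ'.lipschitz_sub
    (half_lt_self (by positivity))).isEmbedding happ'.continuous

/-- If `L` is induced by a complex linear map whose kernel is the line spanned by `X + i J X`, where
`J (J X) = -X`, then `L` is injective, and `J` on the span of `X` and `J X` is the structure
induced by `L`. -/
theorem induced_of_forall_eq_zero_iff {ι κ : Type*} {J : (ι → ℝ) →L[ℝ] (ι → ℝ)} {X : ι → ℝ}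
    (hJ : J (J X) = -X) {L : (ι → ℝ) →L[ℝ] (κ → ℂ)} {T : (ι → ℂ) →L[ℂ] (κ → ℂ)}
    (hT : ∀ v, L v = T fun j => (v j : ℂ))
    (hker : ∀ w, T w = 0 ↔ ∃ a : ℂ, w = a • fun j => (X j : ℂ) + Complex.I * (J X j : ℂ)) :
    Function.Injective L ∧
      (Submodule.span ℝ {X, J X} : Set (ι → ℝ)) = {v | Complex.I • L v ∈ Set.range L} ∧
      ∀ v ∈ Submodule.span ℝ {X, J X}, L (J v) = Complex.I • L v := by
  have hTc : ∀ v w : ι → ℝ, T (fun j => (v j : ℂ) + Complex.I * (w j : ℂ)) =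
      L v + Complex.I • L w := fun v w => by
    rw [hT, hT, ← map_smul, ← map_add]
    rfl
  have hker' : ∀ v w, L v + Complex.I • L w = 0 →
      ∃ a b : ℝ, v = a • X - b • J X ∧ w = b • X + a • J X := fun v w h => by
    rw [← hTc, hker] at h
    obtain ⟨a, ha⟩ := h
    refine ⟨a.re, a.im, funext fun j => ?_, funext fun j => ?_⟩
    · simpa using congrArg Complex.re (congrFun ha j)
    · simpa [add_comm] using congrArg Complex.im (congrFun ha j)
  have hLJ : L (J X) = Complex.I • L X := by
    have h : L X + Complex.I • L (J X) = 0 := by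
      rw [← hTc, hker]
      exact ⟨1, (one_smul _ _).symm⟩
    rw [eq_neg_of_add_eq_zero_left h, smul_neg, smul_smul, Complex.I_mul_I, neg_one_smul, neg_neg]
  have hLI : ∀ v ∈ Submodule.span ℝ {X, J X}, L (J v) = Complex.I • L v := by
    intro v hv
    obtain ⟨a, b, rfl⟩ := Submodule.mem_span_pair.1 hv
    simp only [map_add, map_smul, map_neg, hJ, hLJ, smul_add]
    rw [smul_comm Complex.I b (Complex.I • L X), smul_smul Complex.I Complex.I, Complex.I_mul_I,
      neg_one_smul, smul_comm Complex.I a]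
  refine ⟨(injective_iff_map_eq_zero L).2 fun v hv => ?_, Set.ext fun v => ⟨fun hv => ?_, ?_⟩, hLI⟩
  · obtain ⟨a, b, rfl, h⟩ := hker' v 0 (by simp [hv])
    have h' := congrArg J h
    simp only [map_zero, map_add, map_smul, hJ] at h'
    rw [← neg_eq_zero, h']
    module
  · exact ⟨J v, hLI v hv⟩
  · rintro ⟨w, hw⟩
    obtain ⟨a, b, -, h⟩ := hker' (-w) v (by rw [map_neg, hw, neg_add_cancel])
    exact Submodule.mem_span_pair.2 ⟨b, a, h.symm⟩


/-- local embeddability of nondegenerate real analytic CR-structures: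
let `(D, I)` be a nondegenerate real analytic CR-structure on a `3`-manifold —
modelled, since the statement is purely local, on an open set `U ⊆ ℝ³`: `D` is a
rank-`2` plane field, locally spanned by the real analytic nonvanishing fields
`X, I X`, `I : D → D` is real analytic with `I² = −Id_D`, and `D` is a contact plane
field (`[X, IX] ∉ D`).  Then every `p ∈ U` has an open neighbourhood `U_p` and a real
analytic embedding `φ : U_p → ℂ²` such that `(D, I)` is the CR-structure induced on
`U_p` by `φ` and the standard complex structure of `ℂ²` (i.e. `dφ(D_q)` is the largest
`i`-invariant subspace of the tangent space of the image and `dφ ∘ I = i • dφ` on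
`D`). -/
theorem stmt14
    (U : Set (Fin 3 → ℝ)) (hU : IsOpen U)
    (D : (Fin 3 → ℝ) → Submodule ℝ (Fin 3 → ℝ))
    (I : (Fin 3 → ℝ) → ((Fin 3 → ℝ) →L[ℝ] (Fin 3 → ℝ)))
    (hCR : ∀ p ∈ U, ∀ v ∈ D p, I p v ∈ D p ∧ I p (I p v) = -v)
    (hreg : ∀ p ∈ U, ∃ r > (0 : ℝ), Metric.ball p r ⊆ U ∧
      AnalyticOnNhd ℝ I (Metric.ball p r) ∧
      ∃ X : (Fin 3 → ℝ) → (Fin 3 → ℝ),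
        AnalyticOnNhd ℝ X (Metric.ball p r) ∧
        ∀ q ∈ Metric.ball p r,
          X q ≠ 0 ∧ X q ∈ D q ∧
          D q = Submodule.span ℝ {X q, I q (X q)} ∧
          VectorField.lieBracket ℝ X (fun z => I z (X z)) q ∉ D q) :
    ∀ p ∈ U, ∃ Up : Set (Fin 3 → ℝ), IsOpen Up ∧ p ∈ Up ∧ Up ⊆ U ∧
      ∃ φ : (Fin 3 → ℝ) → (Fin 2 → ℂ),
        AnalyticOnNhd ℝ φ Up ∧
        Set.InjOn φ Up ∧
        (∀ q ∈ Up, Function.Injective (fderiv ℝ φ q)) ∧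
        Topology.IsEmbedding (Up.restrict φ) ∧
        ∀ q ∈ Up,
          ((D q : Set (Fin 3 → ℝ)) =
            {v | Complex.I • (fderiv ℝ φ q v) ∈ Set.range (fderiv ℝ φ q)}) ∧
          (∀ v ∈ D q, fderiv ℝ φ q (I q v) = Complex.I • fderiv ℝ φ q v) := by
  intro p hp
  obtain ⟨r, hr, hrU, hI, X, hX, hXD⟩ := hreg p hp
  have hpr : p ∈ Metric.ball p r := Metric.mem_ball_self hr
  have hIX : AnalyticAt ℝ (fun z => I z (X z)) p :=
    ((hI p hpr).contDiffAt (n := ⊤)).clm_apply ((hX p hpr).contDiffAt (n := ⊤)) |>.analyticAt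
  have hproj : ∀ {Y : (Fin 3 → ℝ) → (Fin 3 → ℝ)}, AnalyticAt ℝ Y p → ∀ j,
      AnalyticAt ℝ (fun y => (Y y j : ℂ)) p := fun hY j =>
    ((Complex.ofRealCLM ∘L ContinuousLinearMap.proj (R := ℝ) (φ := fun _ : Fin 3 => ℝ) j).analyticAt
      _).comp hY
  let F : (Fin 3 → ℝ) → (Fin 3 → ℂ) := fun y j => (X y j : ℂ) + Complex.I * (I y (X y) j : ℂ)
  have hF : AnalyticAt ℝ F p := AnalyticAt.pi fun j =>
    (hproj (hX p hpr) j).fun_add (analyticAt_const.fun_mul (hproj hIX j))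
  have hFp : F p ≠ 0 := fun h => (hXD p hpr).1 <| funext fun j => by
    simpa [F] using congrArg Complex.re (congrFun h j)
  obtain ⟨φ, hφ, hker⟩ := exists_real_firstIntegrals hF hFp
  have hinduced : ∀ᶠ q in 𝓝 p, Function.Injective (fderiv ℝ φ q) ∧
      ((D q : Set (Fin 3 → ℝ)) =
        {v | Complex.I • (fderiv ℝ φ q v) ∈ Set.range (fderiv ℝ φ q)}) ∧
      ∀ v ∈ D q, fderiv ℝ φ q (I q v) = Complex.I • fderiv ℝ φ q v := by
    filter_upwards [hker, Metric.ball_mem_nhds p hr] with q ⟨T, hT, hTker⟩ hq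
    obtain ⟨-, hXq, hD, -⟩ := hXD q hq
    rw [hD]
    exact induced_of_forall_eq_zero_iff (hCR q (hrU hq) _ hXq).2 hT hTker
  obtain ⟨s, hs, hemb⟩ := HasStrictFDerivAt.exists_isEmbedding_domRestrict
    hφ.hasStrictFDerivAt hinduced.self_of_nhds.1
  obtain ⟨Up, hUp, hUpo, hpUp⟩ := mem_nhds_iff.1 (Filter.inter_mem
    (Filter.inter_mem hs (Metric.ball_mem_nhds p hr))
    (Filter.inter_mem hinduced hφ.eventually_analyticAt))
  have hφUp := hemb Up fun q hq => (hUp hq).1.1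
  exact ⟨Up, hUpo, hpUp, fun q hq => hrU (hUp hq).1.2, φ, fun q hq => (hUp hq).2.2,
    Set.injOn_iff_injective.2 hφUp.injective, fun q hq => (hUp hq).2.1.1, hφUp,
    fun q hq => (hUp hq).2.1.2⟩
end

section
/- Let M ⊂ ℂ² be a nondegenerate hypersurface. Then the CR-structure (D, I) induced on M by the standard complex structure J of ℂ² (D_p the largest J_p-invariant subspace of T_pM, I_p the restriction of J_p to D_p) is compatible with the path geometry (P₁,P₂) induced on M by the splitting ({ω₀},{φ₀}), i.e. D = P₁ ⊕ P₂ and I(P₁) = P₂, where ω₀ = Re(dz¹∧dz²) and φ₀ = Im(dz¹∧dz²). -/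
open scoped ContDiff

/-- `ω₀ = Re(dz¹∧dz²)` on `ℂ²`, evaluated on a pair of tangent vectors. -/
noncomputable def omegaC (u v : Fin 2 → ℂ) : ℝ := (u 0 * v 1 - u 1 * v 0).re

/-- `φ₀ = Im(dz¹∧dz²)` on `ℂ²`, evaluated on a pair of tangent vectors. -/
noncomputable def phiC (u v : Fin 2 → ℂ) : ℝ := (u 0 * v 1 - u 1 * v 0).im

/-- The tangent space at `φ q` of the hypersurface in `ℂ²` parametrised by the
immersion `φ`. -/
noncomputable def tanSp (φ : (Fin 3 → ℝ) → (Fin 2 → ℂ)) (q : Fin 3 → ℝ) :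
    Set (Fin 2 → ℂ) :=
  Set.range (fderiv ℝ φ q)

/-- The fibre of the CR-structure induced by the complex structure of `ℂ²`: the
largest `i`-invariant subspace of the tangent space. -/
noncomputable def indD (φ : (Fin 3 → ℝ) → (Fin 2 → ℂ)) (q : Fin 3 → ℝ) :
    Set (Fin 2 → ℂ) :=
  {u | u ∈ tanSp φ q ∧ Complex.I • u ∈ tanSp φ q}

/-- The fibre of one of the two line fields of the path geometry induced by the
splitting `({ω₀},{φ₀})`: the kernel of the `2`-form `B ∈ {ω₀, φ₀}` restricted to the
tangent space. -/
noncomputable def indP (B : (Fin 2 → ℂ) → (Fin 2 → ℂ) → ℝ)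
    (φ : (Fin 3 → ℝ) → (Fin 2 → ℂ)) (q : Fin 3 → ℝ) : Set (Fin 2 → ℂ) :=
  {u | u ∈ tanSp φ q ∧ ∀ w ∈ tanSp φ q, B u w = 0}

/-- The real linear functional `ω₀(c, ·)`. -/
noncomputable def omegaCFunctional (c : Fin 2 → ℂ) : (Fin 2 → ℂ) →ₗ[ℝ] ℝ where
  toFun := omegaC c
  map_add' u v := by simp [omegaC]; ring
  map_smul' r u := by simp [omegaC]; ring

theorem phiC_I_smul (u w : Fin 2 → ℂ) : phiC (Complex.I • u) w = omegaC u w := by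
  simp [phiC, omegaC]; ring

theorem omegaC_I_smul (u w : Fin 2 → ℂ) : omegaC (Complex.I • u) w = -phiC u w := by
  simp [phiC, omegaC]; ring

theorem omegaC_smul_I_smul (u : Fin 2 → ℂ) : omegaC u (Complex.I • u) = 0 := by
  simp [omegaC]; ring

/-- The complex symplectic form `dz¹∧dz²` pairs a nonzero vector surjectively onto `ℂ`. -/
theorem exists_det_eq {c : Fin 2 → ℂ} (hc : c ≠ 0) (z : ℂ) :
    ∃ w : Fin 2 → ℂ, c 0 * w 1 - c 1 * w 0 = z := by
  by_cases h0 : c 0 = 0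
  · have h1 : c 1 ≠ 0 := fun h1 => hc (by ext i; fin_cases i <;> simp [h0, h1])
    exact ⟨![-z / c 1, 0], by simp; field_simp⟩
  · exact ⟨![0, z / c 0], by simp; field_simp⟩

/-- A vector annihilated by `dz¹∧dz²(c, ·)` is a complex multiple of `c ≠ 0`. -/
theorem exists_eq_smul_of_det_eq_zero {c d : Fin 2 → ℂ} (hc : c ≠ 0)
    (h : c 0 * d 1 - c 1 * d 0 = 0) : ∃ l : ℂ, d = l • c := by
  by_cases h0 : c 0 = 0
  · have h1 : c 1 ≠ 0 := fun h1 => hc (by ext i; fin_cases i <;> simp [h0, h1])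
    have hd : d 0 = 0 := by simpa [h0, h1] using h
    exact ⟨d 1 / c 1, by ext i; fin_cases i <;> simp [h0, h1, hd]⟩
  · refine ⟨d 0 / c 0, ?_⟩
    ext i
    fin_cases i
    · simp [h0]
    · simp only [Fin.mk_one, Pi.smul_apply, smul_eq_mul]
      field_simp
      linear_combination h

/-- A real hyperplane of `ℂ²` on which `ω₀(c, ·)` vanishes, `c ≠ 0`, is its kernel. -/
theorem mem_range_iff_omegaC_eq_zero {L : (Fin 3 → ℝ) →L[ℝ] (Fin 2 → ℂ)}
    (hL : Function.Injective L) {c : Fin 2 → ℂ} (hc : c ≠ 0)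
    (h : ∀ w ∈ Set.range L, omegaC c w = 0) (w : Fin 2 → ℂ) :
    w ∈ Set.range L ↔ omegaC c w = 0 := by
  refine ⟨h w, fun hw => ?_⟩
  have hle : LinearMap.range L.toLinearMap ≤ LinearMap.ker (omegaCFunctional c) := by
    rintro _ ⟨v, rfl⟩
    exact h _ ⟨v, rfl⟩
  have hrange : Module.finrank ℝ (LinearMap.range L.toLinearMap) = 3 := by
    rw [LinearMap.finrank_range_of_inj hL]; simp
  have hne : omegaCFunctional c ≠ 0 := by
    intro h0
    obtain ⟨v, hv⟩ := exists_det_eq hc 1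
    have h1 : omegaC c v = 0 := LinearMap.congr_fun h0 v
    simp [omegaC, hv] at h1
  have hker := Module.Dual.finrank_ker_add_one_of_ne_zero hne
  have h4 : Module.finrank ℝ (Fin 2 → ℂ) = 4 := by
    simp [Module.finrank_pi_fintype]
  have heq := Submodule.eq_of_le_of_finrank_le hle (by omega)
  have hmem : w ∈ LinearMap.ker (omegaCFunctional c) := hw
  rw [← heq] at hmem
  exact hmem

/-- Multiplication by `i` maps `P₁` into `P₂`. -/
theorem I_smul_mem_indP_phiC {φ : (Fin 3 → ℝ) → (Fin 2 → ℂ)} {q : Fin 3 → ℝ}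
    (himm : Function.Injective (fderiv ℝ φ q)) {u : Fin 2 → ℂ}
    (hu : u ∈ indP omegaC φ q) : Complex.I • u ∈ indP phiC φ q := by
  refine ⟨?_, fun w hw => by rw [phiC_I_smul, hu.2 w hw]⟩
  rcases eq_or_ne u 0 with rfl | h0
  · exact ⟨0, by simp⟩
  · exact (mem_range_iff_omegaC_eq_zero himm h0 hu.2 _).2 (omegaC_smul_I_smul u)

/-- Multiplication by `i` maps `P₂` into `P₁`. -/
theorem I_smul_mem_indP_omegaC {φ : (Fin 3 → ℝ) → (Fin 2 → ℂ)} {q : Fin 3 → ℝ}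
    (himm : Function.Injective (fderiv ℝ φ q)) {u : Fin 2 → ℂ}
    (hu : u ∈ indP phiC φ q) : Complex.I • u ∈ indP omegaC φ q := by
  have hom : ∀ w ∈ tanSp φ q, omegaC (Complex.I • u) w = 0 := fun w hw => by
    rw [omegaC_I_smul, hu.2 w hw, neg_zero]
  refine ⟨?_, hom⟩
  rcases eq_or_ne u 0 with rfl | h0
  · exact ⟨0, by simp⟩
  · refine (mem_range_iff_omegaC_eq_zero himm (smul_ne_zero Complex.I_ne_zero h0) hom _).2 ?_
    simp [omegaC]; ring

/-- let `M ⊂ ℂ²` be a nondegenerate hypersurface (here parametrised by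
a smooth embedding `φ` of an open set `U ⊆ ℝ³`; nondegeneracy: the two induced line
fields span a contact plane field).  Then the CR-structure `(D, I)` induced on `M` by
the standard complex structure of `ℂ²` (`D_p` the largest `i`-invariant subspace of
`T_pM`, `I` the restriction of multiplication by `i`) is compatible with the path
geometry `(P₁, P₂)` induced by the splitting `({ω₀},{φ₀})`, i.e. `D = P₁ ⊕ P₂` and
`I(P₁) = P₂`. -/
theorem stmt15
    (U : Set (Fin 3 → ℝ)) (hU : IsOpen U)
    (φ : (Fin 3 → ℝ) → (Fin 2 → ℂ))
    (hφ : ContDiffOn ℝ ∞ φ U)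
    (hinj : Set.InjOn φ U)
    (himm : ∀ q ∈ U, Function.Injective (fderiv ℝ φ q))
    (hemb : Topology.IsEmbedding (U.restrict φ))
    (hnd : ∀ p ∈ U, ∃ r > (0 : ℝ), Metric.ball p r ⊆ U ∧
      ∃ X Y : (Fin 3 → ℝ) → (Fin 3 → ℝ),
        ContDiffOn ℝ ∞ X (Metric.ball p r) ∧ ContDiffOn ℝ ∞ Y (Metric.ball p r) ∧
        ∀ q ∈ Metric.ball p r,
          X q ≠ 0 ∧ Y q ≠ 0 ∧
          (∀ w, omegaC (fderiv ℝ φ q (X q)) (fderiv ℝ φ q w) = 0) ∧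
          (∀ w, phiC (fderiv ℝ φ q (Y q)) (fderiv ℝ φ q w) = 0) ∧
          LinearIndependent ℝ ![X q, Y q] ∧
          VectorField.lieBracket ℝ X Y q ∉ Submodule.span ℝ {X q, Y q}) :
    ∀ q ∈ U,
      -- `D = P₁ ⊕ P₂` :
      indD φ q = {u | ∃ a ∈ indP omegaC φ q, ∃ b ∈ indP phiC φ q, u = a + b} ∧
      indP omegaC φ q ∩ indP phiC φ q = {0} ∧
      -- `I(P₁) = P₂` :
      (Complex.I • ·) '' indP omegaC φ q = indP phiC φ q := by
  intro q hq
  have hL := himm q hq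
  obtain ⟨r, hr, -, X, Y, -, -, hXY⟩ := hnd q hq
  obtain ⟨hX, -, hom, -⟩ := hXY q (Metric.mem_ball_self hr)
  have zero_mem : (0 : Fin 2 → ℂ) ∈ tanSp φ q := ⟨0, map_zero _⟩
  have smul_mem : ∀ (t : ℝ) {u}, u ∈ tanSp φ q → t • u ∈ tanSp φ q := by
    rintro t _ ⟨v, rfl⟩
    exact ⟨t • v, map_smul _ _ _⟩
  have add_mem : ∀ {u v}, u ∈ tanSp φ q → v ∈ tanSp φ q → u + v ∈ tanSp φ q := by
    rintro _ _ ⟨v, rfl⟩ ⟨w, rfl⟩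
    exact ⟨v + w, map_add _ _ _⟩
  refine ⟨?_, ?_, ?_⟩
  · set a := fderiv ℝ φ q (X q) with ha
    have ha0 : a ≠ 0 := fun h => hX (hL (by rw [← ha, h, map_zero]))
    have haP : a ∈ indP omegaC φ q := ⟨⟨_, rfl⟩, by rintro _ ⟨w, rfl⟩; exact hom w⟩
    ext d
    constructor
    · rintro ⟨hd, hId⟩
      have hre : omegaC a d = 0 := haP.2 d hd
      have him : omegaC a (Complex.I • d) = 0 := haP.2 _ hId
      have hdet : a 0 * d 1 - a 1 * d 0 = 0 := by
        apply Complex.ext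
        · exact hre
        · simp [omegaC] at him ⊢
          linarith
      obtain ⟨l, rfl⟩ := exists_eq_smul_of_det_eq_zero ha0 hdet
      have hIa := I_smul_mem_indP_phiC hL haP
      refine ⟨l.re • a, ⟨smul_mem _ haP.1, fun w hw => ?_⟩,
        l.im • Complex.I • a, ⟨smul_mem _ hIa.1, fun w hw => ?_⟩, ?_⟩
      · have := haP.2 w hw
        simp [omegaC] at this ⊢
        linear_combination l.re * this
      · have := hIa.2 w hw
        simp [phiC] at this ⊢
        linear_combination l.im * this
      · ext i
        simp only [Pi.add_apply, Pi.smul_apply, smul_eq_mul, Complex.real_smul]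
        linear_combination (-a i) * Complex.re_add_im l
    · rintro ⟨b, hb, c, hc, rfl⟩
      refine ⟨add_mem hb.1 hc.1, ?_⟩
      rw [smul_add]
      exact add_mem (I_smul_mem_indP_phiC hL hb).1 (I_smul_mem_indP_omegaC hL hc).1
  · ext u
    constructor
    · rintro ⟨h1, h2⟩
      by_contra h0
      obtain ⟨w, hw⟩ := exists_det_eq h0 Complex.I
      have := h2.2 w ((mem_range_iff_omegaC_eq_zero hL h0 h1.2 w).2 (by simp [omegaC, hw]))
      simp [phiC, hw] at this
    · rintro rfl
      exact ⟨⟨zero_mem, by simp [omegaC]⟩, ⟨zero_mem, by simp [phiC]⟩⟩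
  · ext v
    constructor
    · rintro ⟨u, hu, rfl⟩
      exact I_smul_mem_indP_phiC hL hu
    · intro hv
      have h := I_smul_mem_indP_omegaC hL hv
      refine ⟨(-1 : ℝ) • Complex.I • v, ⟨smul_mem _ h.1, fun w hw => ?_⟩, ?_⟩
      · have := h.2 w hw
        simp [omegaC] at this ⊢
        linarith
      · ext i
        simp [← mul_assoc]
end
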